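/- Let r > 0, b > 0, and let w : D²(r) → ℝ be a nonnegative C² function on the open disk of radius r such that Δw ≥ −b·w² on D²(r), where Δ denotes the Laplacian. If w is Lebesgue integrable on D²(r) and ∫_{D²(r)} w dA < π/(8b), then w(0) ≤ (8/(π·r²))·∫_{D²(r)} w dA. -/

import Mathlib

open MeasureTheory Real

/-- The Laplacian of a function `w : ℂ → ℝ`, computed as the sum of the second
directional derivatives in the directions `1` and `i` (i.e. `∂²w/∂x² + ∂²w/∂y²`). -/
noncomputable def lap (w : ℂ → ℝ) (z : ℂ) : ℝ :=
  fderiv ℝ (fun y => fderiv ℝ w y 1) z 1 +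
    fderiv ℝ (fun y => fderiv ℝ w y Complex.I) z Complex.I

open Set Filter Topology in
lemma param_deriv (F F' : ℝ → ℝ → ℝ) (a b : ℝ)
    (hF : Continuous (fun p : ℝ × ℝ => F p.1 p.2))
    (hF' : Continuous (fun p : ℝ × ℝ => F' p.1 p.2))
    (hd : ∀ x t, HasDerivAt (fun x => F x t) (F' x t) x) (x₀ : ℝ) :
    HasDerivAt (fun x => ∫ t in a..b, F x t) (∫ t in a..b, F' x₀ t) x₀ := by
  have hFx : ∀ x, Continuous (F x) := fun x =>
    hF.comp (Continuous.prodMk continuous_const continuous_id)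
  have hFx' : ∀ x, Continuous (F' x) := fun x =>
    hF'.comp (Continuous.prodMk continuous_const continuous_id)
  have hK : IsCompact (Metric.closedBall x₀ 1 ×ˢ uIcc a b) :=
    (isCompact_closedBall x₀ 1).prod isCompact_uIcc
  obtain ⟨C, hC⟩ := hK.exists_bound_of_continuousOn hF'.continuousOn
  refine (intervalIntegral.hasDerivAt_integral_of_dominated_loc_of_deriv_le
    (s := Metric.closedBall x₀ 1) (bound := fun _ => C)
    (Metric.closedBall_mem_nhds x₀ one_pos) ?_ ?_ ?_ ?_ ?_ ?_).2
  · exact Eventually.of_forall fun x => (hFx x).aestronglyMeasurable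
  · exact (hFx x₀).intervalIntegrable _ _
  · exact (hFx' x₀).aestronglyMeasurable
  · exact Eventually.of_forall fun t ht x hx => hC (x, t) ⟨hx, uIoc_subset_uIcc ht⟩
  · exact intervalIntegrable_const
  · exact Eventually.of_forall fun t _ x _ => hd x t

/-- unit vector -/
noncomputable def eC (t : ℝ) : ℂ := (Real.cos t : ℂ) + (Real.sin t : ℂ) * Complex.I
/-- rotated unit vector -/
noncomputable def fC (t : ℝ) : ℂ := -(Real.sin t : ℂ) + (Real.cos t : ℂ) * Complex.I

lemma cont_eC : Continuous eC := by unfold eC; fun_prop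
lemma cont_fC : Continuous fC := by unfold fC; fun_prop

lemma deriv_eC (t : ℝ) : HasDerivAt eC (fC t) t := by
  have h1 := (Real.hasDerivAt_cos t).ofReal_comp
  have h2 := ((Real.hasDerivAt_sin t).ofReal_comp).mul_const Complex.I
  have := h1.add h2
  refine this.congr_deriv ?_
  simp [fC]

lemma deriv_fC (t : ℝ) : HasDerivAt fC (-eC t) t := by
  have h1 := (Real.hasDerivAt_sin t).ofReal_comp.neg
  have h2 := ((Real.hasDerivAt_cos t).ofReal_comp).mul_const Complex.I
  have := h1.add h2
  refine this.congr_deriv ?_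
  simp [eC]; ring

lemma norm_eC (t : ℝ) : ‖eC t‖ = 1 := by
  unfold eC
  push_cast
  exact Complex.norm_cos_add_sin_mul_I t

lemma lap_eq (u : ℂ → ℝ) (hu : ContDiff ℝ 2 u) (z : ℂ) :
    lap u z = fderiv ℝ (fderiv ℝ u) z 1 1 + fderiv ℝ (fderiv ℝ u) z Complex.I Complex.I := by
  have h : DifferentiableAt ℝ (fderiv ℝ u) z :=
    (hu.fderiv_right (m := 1) (by norm_num)).differentiable (by norm_num) z
  unfold lap
  rw [fderiv_clm_apply h (differentiableAt_const _), fderiv_clm_apply h (differentiableAt_const _)]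
  simp

lemma lap_rot (u : ℂ → ℝ) (hu : ContDiff ℝ 2 u) (z : ℂ) (t : ℝ) :
    lap u z = fderiv ℝ (fderiv ℝ u) z (eC t) (eC t) + fderiv ℝ (fderiv ℝ u) z (fC t) (fC t) := by
  rw [lap_eq u hu]
  have he : eC t = Real.cos t • (1 : ℂ) + Real.sin t • Complex.I := by
    simp [eC]
  have hf : fC t = (-Real.sin t) • (1 : ℂ) + Real.cos t • Complex.I := by
    simp [fC]
  rw [he, hf]
  simp only [map_add, map_smul, _root_.add_apply, _root_.smul_apply,
    smul_eq_mul]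
  set A := fderiv ℝ (fderiv ℝ u) z 1 1
  set B := fderiv ℝ (fderiv ℝ u) z Complex.I Complex.I
  linear_combination (-(A + B)) * Real.sin_sq_add_cos_sq t

lemma deriv_M (u : ℂ → ℝ) (hu : ContDiff ℝ 2 u) (z₀ : ℂ) (s : ℝ) :
    HasDerivAt (fun s : ℝ => ∫ t in (-π)..π, u (z₀ + s * eC t))
      (∫ t in (-π)..π, fderiv ℝ u (z₀ + s * eC t) (eC t)) s := by
  have hc : Continuous (fderiv ℝ u) := hu.continuous_fderiv (by norm_num)
  have hce := cont_eC
  have hcu := hu.continuous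
  refine param_deriv (fun s t => u (z₀ + s * eC t))
    (fun s t => fderiv ℝ u (z₀ + s * eC t) (eC t)) _ _ (by fun_prop) ?_ ?_ s
  · exact Continuous.clm_apply (by fun_prop) (by fun_prop)
  · intro x t
    have h1 : HasDerivAt (fun x : ℝ => z₀ + x * eC t) (eC t) x := by
      simpa using ((Complex.ofRealCLM.hasDerivAt (x := x)).mul_const (eC t)).const_add z₀
    exact (hu.differentiable (by norm_num) _).hasFDerivAt.comp_hasDerivAt x h1

lemma deriv_G (u : ℂ → ℝ) (hu : ContDiff ℝ 2 u) (z₀ : ℂ) (s : ℝ) :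
    HasDerivAt (fun s : ℝ => s * ∫ t in (-π)..π, fderiv ℝ u (z₀ + s * eC t) (eC t))
      (s * ∫ t in (-π)..π, lap u (z₀ + s * eC t)) s := by
  have hc : Continuous (fderiv ℝ u) := hu.continuous_fderiv (by norm_num)
  have hu1 : ContDiff ℝ 1 (fderiv ℝ u) := hu.fderiv_right (m := 1) (by norm_num)
  have hc2 : Continuous (fderiv ℝ (fderiv ℝ u)) := hu1.continuous_fderiv (by norm_num)
  have hce := cont_eC
  have hcf := cont_fC
  have hx : ∀ x t : ℝ, HasDerivAt (fun x : ℝ => z₀ + x * eC t) (eC t) x := fun x t => by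
    simpa using ((Complex.ofRealCLM.hasDerivAt (x := x)).mul_const (eC t)).const_add z₀
  have ht : ∀ x t : ℝ, HasDerivAt (fun t : ℝ => z₀ + x * eC t) (x * fC t) t := fun x t => by
    simpa using ((deriv_eC t).const_mul (x : ℂ)).const_add z₀
  have hD : ∀ z, HasFDerivAt (fderiv ℝ u) (fderiv ℝ (fderiv ℝ u) z) z := fun z =>
    (hu1.differentiable (by norm_num) z).hasFDerivAt
  have h1 := param_deriv (fun s t => fderiv ℝ u (z₀ + s * eC t) (eC t))
    (fun s t => fderiv ℝ (fderiv ℝ u) (z₀ + s * eC t) (eC t) (eC t)) (-π) π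
    (Continuous.clm_apply (by fun_prop) (by fun_prop))
    (Continuous.clm_apply (Continuous.clm_apply (by fun_prop) (by fun_prop)) (by fun_prop))
    (fun x t => by
      have := ((hD _).comp_hasDerivAt x (hx x t)).clm_apply (hasDerivAt_const x (eC t))
      simpa using this) s
  have h2 := (hasDerivAt_id s).mul h1
  refine h2.congr_deriv ?_
  -- angular derivative
  have h3 : ∀ t, HasDerivAt (fun t => fderiv ℝ u (z₀ + s * eC t) (fC t))
      (s * fderiv ℝ (fderiv ℝ u) (z₀ + s * eC t) (fC t) (fC t)
        - fderiv ℝ u (z₀ + s * eC t) (eC t)) t := fun t => by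
    have := ((hD _).comp_hasDerivAt t (ht s t)).clm_apply (deriv_fC t)
    refine this.congr_deriv ?_
    have e : (s : ℂ) * fC t = s • fC t := (Complex.real_smul).symm
    rw [e, map_smul]
    simp only [_root_.smul_apply, smul_eq_mul, map_neg, Function.comp, sub_eq_add_neg]
  have c1 : Continuous fun t => fderiv ℝ (fderiv ℝ u) (z₀ + s * eC t) (fC t) (fC t) :=
    Continuous.clm_apply (Continuous.clm_apply (by fun_prop) (by fun_prop)) (by fun_prop)
  have c2 : Continuous fun t => fderiv ℝ (fderiv ℝ u) (z₀ + s * eC t) (eC t) (eC t) :=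
    Continuous.clm_apply (Continuous.clm_apply (by fun_prop) (by fun_prop)) (by fun_prop)
  have c3 : Continuous fun t => fderiv ℝ u (z₀ + s * eC t) (eC t) :=
    Continuous.clm_apply (by fun_prop) (by fun_prop)
  have h4 := intervalIntegral.integral_eq_sub_of_hasDerivAt (a := -π) (b := π)
    (fun t _ => h3 t) ((((continuous_const.mul c1).sub c3)).intervalIntegrable _ _)
  have e1 : fC (-π) = fC π := by simp [fC]
  have e2 : eC (-π) = eC π := by simp [eC]
  rw [e1, e2, sub_self, intervalIntegral.integral_sub
    ((by fun_prop : Continuous fun t => s * fderiv ℝ (fderiv ℝ u) (z₀ + s * eC t) (fC t)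
      (fC t)).intervalIntegrable _ _) (c3.intervalIntegrable _ _),
    intervalIntegral.integral_const_mul] at h4
  have h5 : ∫ t in (-π)..π, lap u (z₀ + s * eC t) =
      (∫ t in (-π)..π, fderiv ℝ (fderiv ℝ u) (z₀ + s * eC t) (eC t) (eC t)) +
      ∫ t in (-π)..π, fderiv ℝ (fderiv ℝ u) (z₀ + s * eC t) (fC t) (fC t) := by
    rw [← intervalIntegral.integral_add (c2.intervalIntegrable _ _) (c1.intervalIntegrable _ _)]
    exact intervalIntegral.integral_congr fun t _ => lap_rot u hu _ t
  rw [h5]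
  simp only [id]
  linear_combination (-1 : ℝ) * h4

lemma cont_lap (u : ℂ → ℝ) (hu : ContDiff ℝ 2 u) : Continuous (lap u) := by
  have hu1 : ContDiff ℝ 1 (fderiv ℝ u) := hu.fderiv_right (m := 1) (by norm_num)
  have hc2 : Continuous (fderiv ℝ (fderiv ℝ u)) := hu1.continuous_fderiv (by norm_num)
  have : lap u = fun z => fderiv ℝ (fderiv ℝ u) z 1 1 +
      fderiv ℝ (fderiv ℝ u) z Complex.I Complex.I := funext (lap_eq u hu)
  rw [this]
  exact ((hc2.clm_apply continuous_const).clm_apply continuous_const).add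
    ((hc2.clm_apply continuous_const).clm_apply continuous_const)

lemma M_ge (u : ℂ → ℝ) (hu : ContDiff ℝ 2 u) (z₀ : ℂ) (ρ K : ℝ)
    (hK : ∀ z ∈ Metric.ball z₀ ρ, -K ≤ lap u z) (s : ℝ) (hs : 0 ≤ s) (hsρ : s < ρ) :
    2 * π * u z₀ - π * K / 2 * s ^ 2 ≤ ∫ t in (-π)..π, u (z₀ + s * eC t) := by
  have hcl := cont_lap u hu
  have hce := cont_eC
  have hpi := Real.pi_pos
  have hL : ∀ x, 0 ≤ x → x < ρ → -(2 * π * K) ≤ ∫ t in (-π)..π, lap u (z₀ + x * eC t) := by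
    intro x hx hxρ
    have : ∫ t in (-π)..π, -K ≤ ∫ t in (-π)..π, lap u (z₀ + x * eC t) := by
      refine intervalIntegral.integral_mono_on (by linarith) intervalIntegrable_const
        ((by fun_prop : Continuous fun t : ℝ => lap u (z₀ + x * eC t)).intervalIntegrable _ _) ?_
      intro t _
      apply hK
      simp [norm_eC, abs_of_nonneg hx, hxρ]
    rw [intervalIntegral.integral_const] at this
    simp only [smul_eq_mul] at this
    linarith
  -- first monotonicity
  have hG : ∀ x, 0 ≤ x → x < ρ →
      -(π * K * x ^ 2) ≤ x * ∫ t in (-π)..π, fderiv ℝ u (z₀ + x * eC t) (eC t) := by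
    intro x hx hxρ
    have hd : ∀ y : ℝ, HasDerivAt (fun s : ℝ => (s * ∫ t in (-π)..π, fderiv ℝ u (z₀ + s * eC t) (eC t))
        + π * K * s ^ 2) ((y * ∫ t in (-π)..π, lap u (z₀ + y * eC t)) + π * K * (2 * y)) y := by
      intro y
      refine (deriv_G u hu z₀ y).add ?_
      simpa using (hasDerivAt_pow 2 y).const_mul (π * K)
    have hm : MonotoneOn (fun s : ℝ => (s * ∫ t in (-π)..π, fderiv ℝ u (z₀ + s * eC t) (eC t))
        + π * K * s ^ 2) (Set.Icc 0 x) := by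
      refine monotoneOn_of_deriv_nonneg (convex_Icc 0 x)
        (fun y _ => (hd y).continuousAt.continuousWithinAt)
        (fun y _ => (hd y).differentiableAt.differentiableWithinAt) ?_
      intro y hy
      rw [interior_Icc] at hy
      rw [(hd y).deriv]
      have := mul_le_mul_of_nonneg_left (hL y hy.1.le (hy.2.trans hxρ)) hy.1.le
      linarith
    have := hm (Set.left_mem_Icc.2 hx) (Set.right_mem_Icc.2 hx) hx
    simp only [zero_mul] at this
    norm_num at this
    linarith
  have hd : ∀ y : ℝ, HasDerivAt (fun s : ℝ => (∫ t in (-π)..π, u (z₀ + s * eC t))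
      + π * K / 2 * s ^ 2) ((∫ t in (-π)..π, fderiv ℝ u (z₀ + y * eC t) (eC t))
        + π * K / 2 * (2 * y)) y := by
    intro y
    refine (deriv_M u hu z₀ y).add ?_
    simpa using (hasDerivAt_pow 2 y).const_mul (π * K / 2)
  have hm : MonotoneOn (fun s : ℝ => (∫ t in (-π)..π, u (z₀ + s * eC t))
      + π * K / 2 * s ^ 2) (Set.Icc 0 s) := by
    refine monotoneOn_of_deriv_nonneg (convex_Icc 0 s)
      (fun y _ => (hd y).continuousAt.continuousWithinAt)
      (fun y _ => (hd y).differentiableAt.differentiableWithinAt) ?_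
    intro y hy
    rw [interior_Icc] at hy
    rw [(hd y).deriv]
    have h := hG y hy.1.le (hy.2.trans hsρ)
    refine le_of_mul_le_mul_left ?_ hy.1
    linarith
  have := hm (Set.left_mem_Icc.2 hs) (Set.right_mem_Icc.2 hs) hs
  simp at this
  linarith

lemma ball_polar (u : ℂ → ℝ) (hu : Continuous u) (z₀ : ℂ) (ρ : ℝ) (hρ : 0 < ρ) :
    ∫ z in Metric.ball z₀ ρ, u z = ∫ s in (0:ℝ)..ρ, s * ∫ t in (-π)..π, u (z₀ + s * eC t) := by
  have hce := cont_eC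
  have hpi := Real.pi_pos
  have h1 : ∫ z in Metric.ball z₀ ρ, u z =
      ∫ z, (Metric.ball (0:ℂ) ρ).indicator (fun z => u (z₀ + z)) z := by
    rw [← integral_indicator Metric.isOpen_ball.measurableSet,
      ← integral_add_left_eq_self _ z₀]
    congr 1
    ext z
    simp [Set.indicator]
  rw [h1, ← Complex.integral_comp_polarCoord_symm]
  have h2 : ∫ p in polarCoord.target, p.1 •
      (Metric.ball (0:ℂ) ρ).indicator (fun z => u (z₀ + z)) (Complex.polarCoord.symm p) =
      ∫ p in polarCoord.target, (Set.Ioo 0 ρ ×ˢ Set.Ioo (-π) π).indicator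
        (fun p : ℝ × ℝ => p.1 * u (z₀ + p.1 * eC p.2)) p := by
    refine setIntegral_congr_fun polarCoord.open_target.measurableSet ?_
    intro p hp
    obtain ⟨hp1, hp2⟩ := hp
    have hp1' : 0 < p.1 := hp1
    have hn : ‖Complex.polarCoord.symm p‖ = p.1 := by
      rw [Complex.norm_polarCoord_symm, abs_of_pos hp1']
    by_cases hlt : p.1 < ρ
    · have m1 : Complex.polarCoord.symm p ∈ Metric.ball (0:ℂ) ρ := by
        rw [mem_ball_zero_iff, hn]; exact hlt
      have m2 : p ∈ Set.Ioo 0 ρ ×ˢ Set.Ioo (-π) π := ⟨⟨hp1', hlt⟩, hp2⟩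
      simp only [Set.indicator_of_mem m1, Set.indicator_of_mem m2]
      simp only [smul_eq_mul, Complex.polarCoord_symm_apply, eC]
    · have m1 : Complex.polarCoord.symm p ∉ Metric.ball (0:ℂ) ρ := by
        rw [mem_ball_zero_iff, hn]; exact hlt
      have m2 : p ∉ Set.Ioo 0 ρ ×ˢ Set.Ioo (-π) π := fun h => hlt h.1.2
      simp only [Set.indicator_of_notMem m1, Set.indicator_of_notMem m2, smul_zero]
  rw [h2, setIntegral_indicator (measurableSet_Ioo.prod measurableSet_Ioo)]
  have h3 : polarCoord.target ∩ Set.Ioo 0 ρ ×ˢ Set.Ioo (-π) π = Set.Ioo 0 ρ ×ˢ Set.Ioo (-π) π := by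
    apply Set.inter_eq_right.2
    intro p hp
    exact ⟨hp.1.1, hp.2⟩
  rw [h3, Measure.volume_eq_prod, setIntegral_prod]
  · rw [intervalIntegral.integral_of_le hρ.le, integral_Ioc_eq_integral_Ioo]
    refine setIntegral_congr_fun measurableSet_Ioo fun s _ => ?_
    simp only
    rw [intervalIntegral.integral_of_le (by linarith), integral_Ioc_eq_integral_Ioo,
      integral_const_mul]
  · refine IntegrableOn.mono_set (t := Set.Icc 0 ρ ×ˢ Set.Icc (-π) π) ?_
      (Set.prod_mono Set.Ioo_subset_Icc_self Set.Ioo_subset_Icc_self)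
    exact ContinuousOn.integrableOn_compact (isCompact_Icc.prod isCompact_Icc)
      (by fun_prop)

lemma local_mean (u : ℂ → ℝ) (hu : ContDiff ℝ 2 u) (z₀ : ℂ) (ρ K : ℝ) (hρ : 0 < ρ)
    (hK : ∀ z ∈ Metric.ball z₀ ρ, -K ≤ lap u z) :
    π * ρ ^ 2 * u z₀ - π * K * ρ ^ 4 / 8 ≤ ∫ z in Metric.ball z₀ ρ, u z := by
  rw [ball_polar u hu.continuous z₀ ρ hρ]
  have hcM : Continuous fun s : ℝ => ∫ t in (-π)..π, u (z₀ + s * eC t) :=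
    continuous_iff_continuousAt.2 fun s => (deriv_M u hu z₀ s).continuousAt
  have h1 : ∫ s in (0:ℝ)..ρ, s * (2 * π * u z₀ - π * K / 2 * s ^ 2) ≤
      ∫ s in (0:ℝ)..ρ, s * ∫ t in (-π)..π, u (z₀ + s * eC t) := by
    refine intervalIntegral.integral_mono_on_of_le_Ioo hρ.le
      ((by fun_prop : Continuous fun s : ℝ =>
        s * (2 * π * u z₀ - π * K / 2 * s ^ 2)).intervalIntegrable _ _)
      ((continuous_id.mul hcM).intervalIntegrable _ _) ?_
    intro s hs
    exact mul_le_mul_of_nonneg_left (M_ge u hu z₀ ρ K hK s hs.1.le hs.2) hs.1.le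
  refine le_trans (le_of_eq ?_) h1
  have : ∀ s ∈ Set.uIcc 0 ρ, HasDerivAt (fun s : ℝ => π * u z₀ * s ^ 2 - π * K / 8 * s ^ 4)
      (s * (2 * π * u z₀ - π * K / 2 * s ^ 2)) s := by
    intro s _
    have := ((hasDerivAt_pow 2 s).const_mul (π * u z₀)).sub
      ((hasDerivAt_pow 4 s).const_mul (π * K / 8))
    refine this.congr_deriv ?_
    norm_num; ring
  rw [intervalIntegral.integral_eq_sub_of_hasDerivAt this
    ((by fun_prop : Continuous fun s : ℝ =>
        s * (2 * π * u z₀ - π * K / 2 * s ^ 2)).intervalIntegrable _ _)]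
  ring

lemma exists_ext (r r' : ℝ) (hr' : 0 < r') (hrr : r' < r) (w : ℂ → ℝ)
    (hw : ContDiffOn ℝ 2 w (Metric.ball (0 : ℂ) r)) :
    ∃ u : ℂ → ℝ, ContDiff ℝ 2 u ∧ ∀ z ∈ Metric.closedBall (0 : ℂ) r', u z = w z := by
  let χ : ContDiffBump (0 : ℂ) := ⟨r', (r' + r) / 2, hr', by linarith⟩
  refine ⟨fun z => χ z * w z, ?_, fun z hz => by
    simp only [χ.one_of_mem_closedBall hz, one_mul]⟩
  rw [contDiff_iff_contDiffAt]
  intro z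
  by_cases hz : z ∈ Metric.ball (0 : ℂ) r
  · exact χ.contDiffAt.mul (hw.contDiffAt (Metric.isOpen_ball.mem_nhds hz))
  · have hz2 : z ∉ tsupport χ := by
      rw [χ.tsupport_eq]
      intro h
      apply hz
      rw [mem_closedBall_zero_iff] at h
      rw [mem_ball_zero_iff]
      have : ‖z‖ ≤ (r' + r) / 2 := h
      linarith
    have h0 := notMem_tsupport_iff_eventuallyEq.1 hz2
    refine (contDiffAt_const (c := (0:ℝ))).congr_of_eventuallyEq ?_
    filter_upwards [h0] with y hy
    simp [hy]

lemma lap_congr (u w : ℂ → ℝ) (U : Set ℂ) (hU : IsOpen U) (h : ∀ z ∈ U, u z = w z) (z : ℂ)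
    (hz : z ∈ U) : lap u z = lap w z := by
  have h1 : ∀ y ∈ U, fderiv ℝ u y = fderiv ℝ w y := fun y hy =>
    Filter.EventuallyEq.fderiv_eq (Filter.eventually_of_mem (hU.mem_nhds hy) h)
  have h2 : ∀ v : ℂ, fderiv ℝ (fun y => fderiv ℝ u y v) z = fderiv ℝ (fun y => fderiv ℝ w y v) z :=
    fun v => Filter.EventuallyEq.fderiv_eq
      (Filter.eventually_of_mem (hU.mem_nhds hz) fun y hy => by simp only [h1 y hy])
  unfold lap
  rw [h2, h2]

lemma core (r b : ℝ) (hb : 0 < b) (w : ℂ → ℝ)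
    (hw : ContDiffOn ℝ 2 w (Metric.ball (0 : ℂ) r))
    (hnn : ∀ z ∈ Metric.ball (0 : ℂ) r, 0 ≤ w z)
    (hlap : ∀ z ∈ Metric.ball (0 : ℂ) r, -b * (w z) ^ 2 ≤ lap w z)
    (hint : IntegrableOn w (Metric.ball (0 : ℂ) r))
    (hsmall : ∫ z in Metric.ball (0 : ℂ) r, w z < π / (8 * b))
    (r' : ℝ) (hr' : 0 < r') (hrr : r' < r) :
    r' ^ 2 * w 0 ≤ (8 / π) * ∫ z in Metric.ball (0 : ℂ) r, w z := by
  have hpi := Real.pi_pos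
  set E := ∫ z in Metric.ball (0 : ℂ) r, w z with hE
  have hE0 : 0 ≤ E := setIntegral_nonneg Metric.isOpen_ball.measurableSet hnn
  obtain ⟨u, hu, huw⟩ := exists_ext r r' hr' hrr w hw
  have hsub : Metric.closedBall (0:ℂ) r' ⊆ Metric.ball 0 r := Metric.closedBall_subset_ball hrr
  have hlu : ∀ z ∈ Metric.ball (0 : ℂ) r', -b * (u z) ^ 2 ≤ lap u z := by
    intro z hz
    rw [lap_congr u w _ Metric.isOpen_ball
      (fun y hy => huw y (Metric.ball_subset_closedBall hy)) z hz,
      huw z (Metric.ball_subset_closedBall hz)]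
    exact hlap z (hsub (Metric.ball_subset_closedBall hz))
  have hu0 : ∀ z ∈ Metric.closedBall (0 : ℂ) r', 0 ≤ u z := fun z hz => by
    rw [huw z hz]; exact hnn z (hsub hz)
  have hcu := hu.continuous
  obtain ⟨p, hp, hmax⟩ := (isCompact_closedBall (0:ℂ) r').exists_isMaxOn
    ⟨0, by simp [hr'.le]⟩ (f := fun z => (r' - ‖z‖) ^ 2 * u z) (by fun_prop)
  have hmax' : ∀ z ∈ Metric.closedBall (0:ℂ) r',
    (r' - ‖z‖) ^ 2 * u z ≤ (r' - ‖p‖) ^ 2 * u p := fun z hz => hmax hz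
  have h0 := hmax' 0 (by simp [hr'.le])
  have hw0 : u 0 = w 0 := huw 0 (by simp [hr'.le])
  rw [norm_zero, sub_zero, hw0] at h0
  refine h0.trans ?_
  have hpn : ‖p‖ ≤ r' := by simpa using hp
  have hR : 0 ≤ 8 / π * E := by positivity
  rcases hpn.eq_or_lt with hpe | hplt
  · rw [hpe]; simpa using hR
  set c := u p with hc
  rcases (hu0 p hp).eq_or_lt with hce | hcpos
  · rw [← hc] at hce; rw [← hce]; simpa using hR
  rw [← hc] at hcpos
  set δ := (r' - ‖p‖) / 2 with hδ
  have hδ0 : 0 < δ := by rw [hδ]; linarith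
  have h2δ : r' - ‖p‖ = 2 * δ := by rw [hδ]; ring
  have hball : ∀ z ∈ Metric.ball p δ, ‖z‖ ≤ r' - δ := by
    intro z hz
    rw [mem_ball_iff_norm] at hz
    have := norm_add_le p (z - p)
    rw [add_sub_cancel] at this
    linarith
  have h4c : ∀ z ∈ Metric.ball p δ, u z ≤ 4 * c := by
    intro z hz
    have hzn := hball z hz
    have hzm : z ∈ Metric.closedBall (0:ℂ) r' := by
      rw [mem_closedBall_zero_iff]; linarith
    have h1 := hmax' z hzm
    rw [h2δ] at h1
    have h2 : δ ^ 2 * u z ≤ (r' - ‖z‖) ^ 2 * u z :=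
      mul_le_mul_of_nonneg_right (pow_le_pow_left₀ hδ0.le (by linarith) 2) (hu0 z hzm)
    have h3 : 0 < δ ^ 2 := by positivity
    refine le_of_mul_le_mul_left ?_ h3
    linarith
  have key : ∀ ρ, 0 < ρ → ρ ≤ δ → π * ρ ^ 2 * c - 2 * π * b * c ^ 2 * ρ ^ 4 ≤ E := by
    intro ρ hρ hρδ
    have hbs : Metric.ball p ρ ⊆ Metric.ball p δ := Metric.ball_subset_ball hρδ
    have h1 := local_mean u hu p ρ (16 * b * c ^ 2) hρ (by
      intro z hz
      have hz' := hball z (hbs hz)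
      have hzm : z ∈ Metric.ball (0:ℂ) r' := by
        rw [mem_ball_zero_iff]; linarith
      have h2 := hlu z hzm
      have h3 := pow_le_pow_left₀ (hu0 z (Metric.ball_subset_closedBall hzm)) (h4c z (hbs hz)) 2
      have h4 := mul_le_mul_of_nonneg_left h3 hb.le
      linarith)
    have hsub2 : Metric.ball p ρ ⊆ Metric.closedBall (0:ℂ) r' := by
      intro z hz
      have hz' := hball z (hbs hz)
      rw [mem_closedBall_zero_iff]; linarith
    have h5 : ∫ z in Metric.ball p ρ, u z = ∫ z in Metric.ball p ρ, w z :=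
      setIntegral_congr_fun Metric.isOpen_ball.measurableSet fun z hz => huw z (hsub2 hz)
    have h6 : ∫ z in Metric.ball p ρ, w z ≤ E := by
      refine setIntegral_mono_set hint ?_ (hsub2.trans hsub).eventuallyLE
      filter_upwards [ae_restrict_mem Metric.isOpen_ball.measurableSet] with z hz
      exact hnn z hz
    rw [← hc, h5] at h1
    linarith
  rw [h2δ]
  by_cases hcase : 4 * b * c * δ ^ 2 ≤ 1
  · have h1 := key δ hδ0 le_rfl
    have h2 : 2 * π * b * c ^ 2 * δ ^ 4 ≤ π * c * δ ^ 2 / 2 := by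
      have := mul_le_mul_of_nonneg_left hcase (by positivity : 0 ≤ π * c * δ ^ 2 / 2)
      linarith
    have h3 : π * c * δ ^ 2 ≤ 2 * E := by linarith
    rw [div_mul_eq_mul_div, le_div_iff₀ hpi]
    linarith
  · push Not at hcase
    exfalso
    set q := 1 / (4 * b * c) with hq
    have hq0 : 0 < q := by positivity
    have hqδ : q ≤ δ ^ 2 := by
      rw [hq, div_le_iff₀ (by positivity)]; linarith
    have hs : √q ^ 2 = q := Real.sq_sqrt hq0.le
    have h1 := key (√q) (Real.sqrt_pos.2 hq0) (by
      rw [← Real.sqrt_sq hδ0.le]; exact Real.sqrt_le_sqrt hqδ)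
    have h4 : √q ^ 4 = q ^ 2 := by 
      calc √q ^ 4 = (√q ^ 2) ^ 2 := by ring
        _ = q ^ 2 := by rw [hs]
    rw [hs, h4] at h1
    have h2 : π * q * c - 2 * π * b * c ^ 2 * q ^ 2 = π / (8 * b) := by
      rw [hq]; field_simp; ring
    linarith

/-- Mean value inequality: if `w ≥ 0` is `C²` with `Δw ≥ −b·w²` on the open disk
`D²(r)`, is integrable, and `∫_{D²(r)} w < π/(8b)`, then
`w(0) ≤ (8/(π r²))·∫_{D²(r)} w`. -/
theorem meanvalue_quadratic (r b : ℝ) (hr : 0 < r) (hb : 0 < b) (w : ℂ → ℝ)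
    (hw : ContDiffOn ℝ 2 w (Metric.ball (0 : ℂ) r))
    (hnn : ∀ z ∈ Metric.ball (0 : ℂ) r, 0 ≤ w z)
    (hlap : ∀ z ∈ Metric.ball (0 : ℂ) r, -b * (w z) ^ 2 ≤ lap w z)
    (hint : IntegrableOn w (Metric.ball (0 : ℂ) r))
    (hsmall : ∫ z in Metric.ball (0 : ℂ) r, w z < π / (8 * b)) :
    w 0 ≤ (8 / (π * r ^ 2)) * ∫ z in Metric.ball (0 : ℂ) r, w z := by
  have hpi := Real.pi_pos
  have hc := core r b hb w hw hnn hlap hint hsmall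
  have ht : Filter.Tendsto (fun x : ℝ => x ^ 2 * w 0) (nhdsWithin r (Set.Iio r))
      (nhds (r ^ 2 * w 0)) :=
    ((continuous_pow 2).mul continuous_const).continuousAt.continuousWithinAt
  have h : r ^ 2 * w 0 ≤ (8 / π) * ∫ z in Metric.ball (0 : ℂ) r, w z := by
    refine le_of_tendsto ht ?_
    filter_upwards [Ioo_mem_nhdsLT hr] with x hx
    exact hc x hx.1 hx.2
  have hr2 : 0 < r ^ 2 := by positivity
  have e : (8 / (π * r ^ 2)) * ∫ z in Metric.ball (0 : ℂ) r, w z =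
      ((8 / π) * ∫ z in Metric.ball (0 : ℂ) r, w z) / r ^ 2 := by
    field_simp
  rw [e, le_div_iff₀ hr2]
  linarith
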